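/- arXiv:2006.10293 — 3 statements merged into one kernel-verified Lean document; each statement's English description precedes it below -/
import Mathlib

section
/- Let d, k be positive natural numbers and let μ be a probability measure on ℝ^d with ∫ ‖x‖² dμ(x) < ∞. Let A be a symmetric d×d real matrix with largest eigenvalue λ_max(A), let b_1,…,b_{2k} ∈ ℝ^d with ‖b_i‖ ≤ 1 for all i, c_1,…,c_{2k} ∈ ℝ, d_1,…,d_k ∈ ℝ^d with ‖d_i‖ ≤ 1 for all i, and e_1,…,e_k ∈ ℝ, and suppose there is a real η with λ_max(A) + 2·max_{1≤i≤2k} ‖b_i‖² ≤ η < 1. Define D(x) = (1/2)⟨x, A x⟩ + log(∑_{i=1}^{k} exp(⟨b_i, x⟩ + c_i)) − log(∑_{i=k+1}^{2k} exp(⟨b_i, x⟩ + c_i)) and its c-transform D^c(x) = ⨆_{u ∈ ℝ^d} ( D(u) − (1/2)‖x − u‖² ). Then ∫ D^c dμ ≤ ∫ D dμ + (3k²(∫ ‖x‖² dμ(x) + 1)/(1 − η)) · ( ‖A‖_F² + ∑_{i=1}^{k} [ ‖b_i − d_i‖² + ‖b_{k+i} − d_i‖² + (c_i − e_i)² + (c_{k+i}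 − e_i)² ] ), where ‖A‖_F denotes the Frobenius norm of A. -/
open MeasureTheory
open scoped RealInnerProductSpace

/-- The softmax weights of a finite family of logits. -/
noncomputable def softmax {ι : Type*} [Fintype ι] (w : ι → ℝ) (i : ι) : ℝ :=
  Real.exp (w i) / ∑ j, Real.exp (w j)

section Softmax

variable {ι : Type*} [Fintype ι]

lemma softmax_nonneg (w : ι → ℝ) (i : ι) : 0 ≤ softmax w i := by
  unfold softmax; positivity

lemma sum_exp_pos [Nonempty ι] (w : ι → ℝ) : 0 < ∑ j, Real.exp (w j) :=
  Finset.sum_pos (fun _ _ => Real.exp_pos _) Finset.univ_nonempty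

lemma sum_softmax [Nonempty ι] (w : ι → ℝ) : ∑ i, softmax w i = 1 := by
  unfold softmax
  rw [← Finset.sum_div, div_self (sum_exp_pos w).ne']

lemma sum_softmax_mul (w s : ι → ℝ) :
    ∑ i, softmax w i * s i = (∑ i, Real.exp (w i) * s i) / ∑ j, Real.exp (w j) := by
  rw [Finset.sum_div]
  exact Finset.sum_congr rfl fun i _ => by unfold softmax; ring

lemma abs_sum_softmax_mul_le [Nonempty ι] (w s : ι → ℝ) {n : ℝ} (hs : ∀ i, |s i| ≤ n) :
    |∑ i, softmax w i * s i| ≤ n := by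
  calc |∑ i, softmax w i * s i| ≤ ∑ i, |softmax w i * s i| := Finset.abs_sum_le_sum_abs _ _
    _ ≤ ∑ i, softmax w i * n := by
        refine Finset.sum_le_sum fun i _ => ?_
        rw [abs_mul, abs_of_nonneg (softmax_nonneg w i)]
        exact mul_le_mul_of_nonneg_left (hs i) (softmax_nonneg w i)
    _ = n := by rw [← Finset.sum_mul, sum_softmax, one_mul]

lemma sq_sum_softmax_mul_le [Nonempty ι] (w s : ι → ℝ) :
    (∑ i, softmax w i * s i) ^ 2 ≤ ∑ i, softmax w i * s i ^ 2 :=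
  Real.pow_arith_mean_le_arith_mean_pow_of_even _ _ _ (fun i _ => softmax_nonneg w i)
    (sum_softmax w) even_two

lemma sum_softmax_mul_sq_le [Nonempty ι] (w s : ι → ℝ) {n : ℝ} (hs : ∀ i, |s i| ≤ n) :
    ∑ i, softmax w i * s i ^ 2 ≤ n ^ 2 :=
  (le_abs_self _).trans <| abs_sum_softmax_mul_le w (fun i => s i ^ 2) fun i => by
    rw [abs_pow]; exact pow_le_pow_left₀ (abs_nonneg _) (hs i) 2

lemma softmax_covariance_le [Nonempty ι] (w δ s : ι → ℝ) {m n : ℝ}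
    (hδ : ∀ i, |δ i| ≤ m) (hs : ∀ i, |s i| ≤ n) :
    (∑ i, softmax w i * (δ i * s i)) - (∑ i, softmax w i * δ i) * (∑ i, softmax w i * s i)
      ≤ m * n := by
  obtain ⟨i₀⟩ := ‹Nonempty ι›
  have : Nonempty ι := ⟨i₀⟩
  rcases ((abs_nonneg _).trans (hδ i₀)).eq_or_lt' with hm | hm
  · have h0 : ∀ i, δ i = 0 := fun i => abs_nonpos_iff.mp (hm ▸ hδ i)
    simp [h0, hm]
  rcases ((abs_nonneg _).trans (hs i₀)).eq_or_lt' with hn | hn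
  · have h0 : ∀ i, s i = 0 := fun i => abs_nonpos_iff.mp (hn ▸ hs i)
    simp [h0, hn]
  have h := sq_sum_softmax_mul_le w (fun i => n * δ i - m * s i)
  have e1 : ∑ i, softmax w i * (n * δ i - m * s i) =
      n * (∑ i, softmax w i * δ i) - m * ∑ i, softmax w i * s i := by
    rw [Finset.mul_sum, Finset.mul_sum, ← Finset.sum_sub_distrib]
    exact Finset.sum_congr rfl fun i _ => by ring
  have e2 : ∑ i, softmax w i * (n * δ i - m * s i) ^ 2 =
      n ^ 2 * (∑ i, softmax w i * δ i ^ 2) + m ^ 2 * (∑ i, softmax w i * s i ^ 2)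
        - 2 * (m * n) * ∑ i, softmax w i * (δ i * s i) := by
    simp only [Finset.mul_sum]
    rw [← Finset.sum_add_distrib, ← Finset.sum_sub_distrib]
    exact Finset.sum_congr rfl fun i _ => by ring
  rw [e1, e2] at h
  have h1 := mul_le_mul_of_nonneg_left (sum_softmax_mul_sq_le w δ hδ) (sq_nonneg n)
  have h2 := mul_le_mul_of_nonneg_left (sum_softmax_mul_sq_le w s hs) (sq_nonneg m)
  have hmn := mul_pos hm hn
  refine le_of_mul_le_mul_left ?_ hmn
  nlinarith [sq_nonneg (n * (∑ i, softmax w i * δ i)), sq_nonneg (m * ∑ i, softmax w i * s i)]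

lemma hasDerivAt_sum_exp_mul (w δ s : ι → ℝ) (t : ℝ) :
    HasDerivAt (fun t : ℝ => ∑ i, Real.exp (w i + t * δ i) * s i)
      (∑ i, Real.exp (w i + t * δ i) * (δ i * s i)) t := by
  refine HasDerivAt.fun_sum fun i _ => ?_
  rw [← mul_assoc]
  have h : HasDerivAt (fun t : ℝ => w i + t * δ i) (δ i) t := by
    simpa using ((hasDerivAt_id t).mul_const (δ i)).const_add (w i)
  exact h.exp.mul_const (s i)

lemma hasDerivAt_sum_exp (w δ : ι → ℝ) (t : ℝ) :
    HasDerivAt (fun t : ℝ => ∑ i, Real.exp (w i + t * δ i))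
      (∑ i, Real.exp (w i + t * δ i) * δ i) t := by
  simpa using hasDerivAt_sum_exp_mul w δ (fun _ => 1) t

lemma hasDerivAt_softmax_mean [Nonempty ι] (w δ s : ι → ℝ) (t : ℝ) :
    HasDerivAt (fun t : ℝ => ∑ i, softmax (fun i => w i + t * δ i) i * s i)
      ((∑ i, softmax (fun i => w i + t * δ i) i * (δ i * s i)) -
        (∑ i, softmax (fun i => w i + t * δ i) i * δ i) *
          (∑ i, softmax (fun i => w i + t * δ i) i * s i)) t := by
  simp only [sum_softmax_mul]
  have hZ := (sum_exp_pos fun i => w i + t * δ i).ne'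
  refine ((hasDerivAt_sum_exp_mul w δ s t).fun_div (hasDerivAt_sum_exp w δ t) hZ).congr_deriv ?_
  rw [sub_div, mul_comm (∑ i, Real.exp (w i + t * δ i) * s i), pow_two, mul_div_mul_right _ _ hZ,
    mul_div_mul_comm]

lemma hasDerivAt_log_sum_exp [Nonempty ι] (w δ : ι → ℝ) (t : ℝ) :
    HasDerivAt (fun t : ℝ => Real.log (∑ i, Real.exp (w i + t * δ i)))
      (∑ i, softmax (fun i => w i + t * δ i) i * δ i) t := by
  rw [sum_softmax_mul]
  exact (hasDerivAt_sum_exp w δ t).log (sum_exp_pos fun i => w i + t * δ i).ne'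

lemma softmax_mean_add_mul_sub_le [Nonempty ι] (w δ s : ι → ℝ) {m n : ℝ}
    (hδ : ∀ i, |δ i| ≤ m) (hs : ∀ i, |s i| ≤ n) {t : ℝ} (ht : 0 ≤ t) :
    (∑ i, softmax (fun i => w i + t * δ i) i * s i) - ∑ i, softmax w i * s i ≤ m * n * t := by
  have h := image_sub_le_mul_sub_of_deriv_le
    (f := fun t : ℝ => ∑ i, softmax (fun i => w i + t * δ i) i * s i)
    (fun t => (hasDerivAt_softmax_mean w δ s t).differentiableAt) (C := m * n)
    (fun t => by
      rw [(hasDerivAt_softmax_mean w δ s t).deriv]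
      exact softmax_covariance_le _ δ s hδ hs) ht
  simpa using h

lemma softmax_mean_sub_le [Nonempty ι] (w z s : ι → ℝ) {m n : ℝ}
    (hδ : ∀ i, |z i - w i| ≤ m) (hs : ∀ i, |s i| ≤ n) :
    (∑ i, softmax z i * s i) - ∑ i, softmax w i * s i ≤ m * n := by
  simpa using softmax_mean_add_mul_sub_le w (fun i => z i - w i) s hδ hs zero_le_one

lemma softmax_mean_le_softmax_mean_add_mul [Nonempty ι] (w δ : ι → ℝ) {t : ℝ} (ht : 0 ≤ t) :
    ∑ i, softmax w i * δ i ≤ ∑ i, softmax (fun i => w i + t * δ i) i * δ i := by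
  have h := monotone_of_deriv_nonneg
    (f := fun t : ℝ => ∑ i, softmax (fun i => w i + t * δ i) i * δ i)
    (fun t => (hasDerivAt_softmax_mean w δ δ t).differentiableAt)
    (fun t => by
      rw [(hasDerivAt_softmax_mean w δ δ t).deriv, ← pow_two]
      simp only [← pow_two]
      exact sub_nonneg.mpr (sq_sum_softmax_mul_le _ δ)) ht
  simpa using h

lemma exists_log_sum_exp_sub_eq [Nonempty ι] (w δ : ι → ℝ) :
    ∃ t ∈ Set.Ioo (0 : ℝ) 1, Real.log (∑ i, Real.exp (w i + δ i)) -
      Real.log (∑ i, Real.exp (w i)) = ∑ i, softmax (fun i => w i + t * δ i) i * δ i := by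
  obtain ⟨t, ht, h⟩ := exists_hasDerivAt_eq_slope
    (fun t : ℝ => Real.log (∑ i, Real.exp (w i + t * δ i))) _ zero_lt_one
    (fun t _ => (hasDerivAt_log_sum_exp w δ t).continuousAt.continuousWithinAt)
    (fun t _ => hasDerivAt_log_sum_exp w δ t)
  exact ⟨t, ht, by simpa using h.symm⟩

lemma log_sum_exp_add_le [Nonempty ι] (w δ : ι → ℝ) {m : ℝ} (hδ : ∀ i, |δ i| ≤ m) :
    Real.log (∑ i, Real.exp (w i + δ i)) ≤
      Real.log (∑ i, Real.exp (w i)) + (∑ i, softmax w i * δ i) + m ^ 2 := by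
  obtain ⟨t, ht, h⟩ := exists_log_sum_exp_sub_eq w δ
  have h1 := softmax_mean_add_mul_sub_le w δ δ hδ hδ ht.1.le
  nlinarith [ht.2, mul_self_nonneg m]

lemma le_log_sum_exp_add [Nonempty ι] (w δ : ι → ℝ) :
    Real.log (∑ i, Real.exp (w i)) + (∑ i, softmax w i * δ i) ≤
      Real.log (∑ i, Real.exp (w i + δ i)) := by
  obtain ⟨t, ht, h⟩ := exists_log_sum_exp_sub_eq w δ
  have h1 := softmax_mean_le_softmax_mean_add_mul w δ ht.1.le
  linarith

lemma abs_log_sum_exp_add_sub_le [Nonempty ι] (w δ : ι → ℝ) {m : ℝ} (hδ : ∀ i, |δ i| ≤ m) :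
    |Real.log (∑ i, Real.exp (w i + δ i)) - Real.log (∑ i, Real.exp (w i))| ≤ m := by
  obtain ⟨t, -, h⟩ := exists_log_sum_exp_sub_eq w δ
  rw [h]
  exact abs_sum_softmax_mul_le _ δ hδ

end Softmax

section Matrix

variable {d : ℕ}

lemma norm_toEuclideanLin_sq_le (A : Matrix (Fin d) (Fin d) ℝ) (x : EuclideanSpace ℝ (Fin d)) :
    ‖Matrix.toEuclideanLin A x‖ ^ 2 ≤ (∑ i, ∑ j, A i j ^ 2) * ‖x‖ ^ 2 := by
  rw [EuclideanSpace.real_norm_sq_eq, EuclideanSpace.real_norm_sq_eq, Finset.sum_mul]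
  refine Finset.sum_le_sum fun i _ => ?_
  have : (Matrix.toEuclideanLin A x) i = ∑ j, A i j * x j := by
    simp [Matrix.toLpLin_apply, Matrix.mulVec, dotProduct]
  rw [this]
  exact Finset.sum_mul_sq_le_sq_mul_sq _ _ _

lemma inner_toEuclideanLin_comm {A : Matrix (Fin d) (Fin d) ℝ} (hA : A.IsHermitian)
    (x y : EuclideanSpace ℝ (Fin d)) :
    ⟪x, Matrix.toEuclideanLin A y⟫ = ⟪Matrix.toEuclideanLin A x, y⟫ :=
  ((Matrix.isSymmetric_toEuclideanLin_iff.mpr hA) x y).symm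

lemma inner_toEuclideanLin_le {A : Matrix (Fin d) (Fin d) ℝ} (hA : A.IsHermitian)
    (x : EuclideanSpace ℝ (Fin d)) :
    ⟪x, Matrix.toEuclideanLin A x⟫ ≤ (⨆ i, hA.eigenvalues i) * ‖x‖ ^ 2 := by
  rw [← hA.eigenvectorBasis.sum_inner_mul_inner, ← hA.eigenvectorBasis.sum_sq_norm_inner_right x,
    Finset.mul_sum]
  refine Finset.sum_le_sum fun i _ => ?_
  have h : Matrix.toEuclideanLin A (hA.eigenvectorBasis i) =
      hA.eigenvalues i • hA.eigenvectorBasis i := by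
    rw [Matrix.toLpLin_apply, hA.mulVec_eigenvectorBasis]; rfl
  rw [inner_toEuclideanLin_comm hA, h, real_inner_smul_left, real_inner_comm x,
    Real.norm_eq_abs, sq_abs]
  have := le_ciSup (Set.finite_range hA.eigenvalues).bddAbove i
  nlinarith [sq_nonneg ⟪hA.eigenvectorBasis i, x⟫]

lemma continuous_toEuclideanLin (A : Matrix (Fin d) (Fin d) ℝ) :
    Continuous (Matrix.toEuclideanLin A) :=
  LinearMap.continuous_of_finiteDimensional _

end Matrix

lemma weighted_sum_sq_le (X F a b g h : ℝ) :
    (F * X + a + b + ((a + b) * X + (g + h))) ^ 2 ≤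
      6 * (X ^ 2 + 1) * (F ^ 2 + (a ^ 2 + b ^ 2 + g ^ 2 + h ^ 2)) := by
  have h1 := Finset.sum_mul_sq_le_sq_mul_sq Finset.univ ![X, 1 + X, 1 + X, 1, 1] ![F, a, b, g, h]
  simp only [Fin.sum_univ_five] at h1
  simp at h1
  have h2 : X ^ 2 + (1 + X) ^ 2 + (1 + X) ^ 2 + 1 + 1 ≤ 6 * (X ^ 2 + 1) := by
    nlinarith [sq_nonneg (X - 1), sq_nonneg X]
  have h3 := mul_le_mul_of_nonneg_right h2
    (by positivity : 0 ≤ F ^ 2 + a ^ 2 + b ^ 2 + g ^ 2 + h ^ 2)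
  nlinarith

section Discriminator

variable {d : ℕ} {ι : Type*}

lemma logit_add (b : ι → EuclideanSpace ℝ (Fin d)) (c : ι → ℝ) (x v : EuclideanSpace ℝ (Fin d))
    (i : ι) : ⟪b i, x + v⟫ + c i = (⟪b i, x⟫ + c i) + ⟪b i, v⟫ := by
  rw [inner_add_right]; ring

variable [Fintype ι]

/-- The function `½⟨x, Ax⟩ + log ∑ᵢ exp(⟨b₁ᵢ, x⟩ + c₁ᵢ) - log ∑ᵢ exp(⟨b₂ᵢ, x⟩ + c₂ᵢ)`. -/
noncomputable def softmaxQuadratic (A : Matrix (Fin d) (Fin d) ℝ)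
    (b₁ b₂ : ι → EuclideanSpace ℝ (Fin d)) (c₁ c₂ : ι → ℝ) (x : EuclideanSpace ℝ (Fin d)) : ℝ :=
  (1 / 2) * ⟪x, Matrix.toEuclideanLin A x⟫ +
    Real.log (∑ i, Real.exp (⟪b₁ i, x⟫ + c₁ i)) - Real.log (∑ i, Real.exp (⟪b₂ i, x⟫ + c₂ i))

/-- The derivative at `x` in direction `v` of `softmaxQuadratic` (for symmetric `A`). -/
noncomputable def softmaxQuadraticDeriv (A : Matrix (Fin d) (Fin d) ℝ)
    (b₁ b₂ : ι → EuclideanSpace ℝ (Fin d)) (c₁ c₂ : ι → ℝ) (x v : EuclideanSpace ℝ (Fin d)) : ℝ :=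
  ⟪Matrix.toEuclideanLin A x, v⟫ + (∑ i, softmax (fun i => ⟪b₁ i, x⟫ + c₁ i) i * ⟪b₁ i, v⟫) -
    ∑ i, softmax (fun i => ⟪b₂ i, x⟫ + c₂ i) i * ⟪b₂ i, v⟫

lemma softmaxQuadratic_add_le [Nonempty ι] {A : Matrix (Fin d) (Fin d) ℝ} (hA : A.IsHermitian)
    (b₁ b₂ : ι → EuclideanSpace ℝ (Fin d)) (c₁ c₂ : ι → ℝ) {M : ℝ} (hM : ∀ i, ‖b₁ i‖ ^ 2 ≤ M)
    (x v : EuclideanSpace ℝ (Fin d)) :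
    softmaxQuadratic A b₁ b₂ c₁ c₂ (x + v) ≤ softmaxQuadratic A b₁ b₂ c₁ c₂ x +
      softmaxQuadraticDeriv A b₁ b₂ c₁ c₂ x v +
      ((⨆ i, hA.eigenvalues i) + 2 * M) / 2 * ‖v‖ ^ 2 := by
  obtain ⟨i₀⟩ := ‹Nonempty ι›
  have : Nonempty ι := ⟨i₀⟩
  have hM0 : 0 ≤ M := (sq_nonneg _).trans (hM i₀)
  have hb : ∀ i, |⟪b₁ i, v⟫| ≤ √M * ‖v‖ := fun i =>
    (abs_real_inner_le_norm _ _).trans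
      (mul_le_mul_of_nonneg_right (Real.le_sqrt_of_sq_le (hM i)) (norm_nonneg v))
  have h1 := log_sum_exp_add_le (fun i => ⟪b₁ i, x⟫ + c₁ i) (fun i => ⟪b₁ i, v⟫) hb
  have h2 := le_log_sum_exp_add (fun i => ⟪b₂ i, x⟫ + c₂ i) (fun i => ⟪b₂ i, v⟫)
  have h3 := inner_toEuclideanLin_le hA v
  have h4 : ⟪x + v, Matrix.toEuclideanLin A (x + v)⟫ = ⟪x, Matrix.toEuclideanLin A x⟫ +
      2 * ⟪Matrix.toEuclideanLin A x, v⟫ + ⟪v, Matrix.toEuclideanLin A v⟫ := by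
    rw [map_add, inner_add_left, inner_add_right, inner_add_right, inner_toEuclideanLin_comm hA x v,
      real_inner_comm (Matrix.toEuclideanLin A x) v]
    ring
  rw [mul_pow, Real.sq_sqrt hM0] at h1
  simp only [softmaxQuadratic, softmaxQuadraticDeriv, logit_add, h4]
  linarith

lemma norm_le_sqrt_sum_norm_sq {E : Type*} [SeminormedAddCommGroup E] (f : ι → E) (i : ι) :
    ‖f i‖ ≤ √(∑ j, ‖f j‖ ^ 2) :=
  Real.le_sqrt_of_sq_le <|
    Finset.single_le_sum (f := fun j => ‖f j‖ ^ 2) (fun _ _ => sq_nonneg _) (Finset.mem_univ i)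

lemma abs_softmax_mean_inner_le [Nonempty ι] (w : ι → ℝ) (f : ι → EuclideanSpace ℝ (Fin d))
    (v : EuclideanSpace ℝ (Fin d)) :
    |∑ i, softmax w i * ⟪f i, v⟫| ≤ √(∑ i, ‖f i‖ ^ 2) * ‖v‖ :=
  abs_sum_softmax_mul_le w _ fun i => (abs_real_inner_le_norm _ _).trans
    (mul_le_mul_of_nonneg_right (norm_le_sqrt_sum_norm_sq f i) (norm_nonneg v))

/-- The squared parameter distance controlling `softmaxQuadraticDeriv`. -/
noncomputable def parameterDistSq (A : Matrix (Fin d) (Fin d) ℝ)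
    (b₁ b₂ dv : ι → EuclideanSpace ℝ (Fin d)) (c₁ c₂ e : ι → ℝ) : ℝ :=
  (∑ i, ∑ j, A i j ^ 2) + ∑ i, (‖b₁ i - dv i‖ ^ 2 + ‖b₂ i - dv i‖ ^ 2 +
    (c₁ i - e i) ^ 2 + (c₂ i - e i) ^ 2)

lemma parameterDistSq_nonneg (A : Matrix (Fin d) (Fin d) ℝ)
    (b₁ b₂ dv : ι → EuclideanSpace ℝ (Fin d)) (c₁ c₂ e : ι → ℝ) :
    0 ≤ parameterDistSq A b₁ b₂ dv c₁ c₂ e := by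
  unfold parameterDistSq; positivity

lemma softmaxQuadraticDeriv_le [Nonempty ι] (A : Matrix (Fin d) (Fin d) ℝ)
    (b₁ b₂ dv : ι → EuclideanSpace ℝ (Fin d)) (c₁ c₂ e : ι → ℝ) (hdv : ∀ i, ‖dv i‖ ≤ 1)
    (x v : EuclideanSpace ℝ (Fin d)) :
    softmaxQuadraticDeriv A b₁ b₂ c₁ c₂ x v ≤
      √(6 * (‖x‖ ^ 2 + 1) * parameterDistSq A b₁ b₂ dv c₁ c₂ e) * ‖v‖ := by
  set F := √(∑ i, ∑ j, A i j ^ 2) with hF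
  set α := √(∑ i, ‖b₁ i - dv i‖ ^ 2) with hα
  set β := √(∑ i, ‖b₂ i - dv i‖ ^ 2) with hβ
  set γ := √(∑ i, ‖c₁ i - e i‖ ^ 2) with hγ
  set ε := √(∑ i, ‖c₂ i - e i‖ ^ 2) with hε
  have hT : parameterDistSq A b₁ b₂ dv c₁ c₂ e =
      F ^ 2 + (α ^ 2 + β ^ 2 + γ ^ 2 + ε ^ 2) := by
    rw [hF, hα, hβ, hγ, hε, Real.sq_sqrt (by positivity), Real.sq_sqrt (by positivity),
      Real.sq_sqrt (by positivity), Real.sq_sqrt (by positivity), Real.sq_sqrt (by positivity)]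
    simp only [parameterDistSq, Finset.sum_add_distrib, Real.norm_eq_abs, sq_abs]
  have hK := Real.le_sqrt_of_sq_le (weighted_sum_sq_le ‖x‖ F α β γ ε)
  rw [← hT] at hK
  refine le_trans ?_ (mul_le_mul_of_nonneg_right hK (norm_nonneg v))
  have hAx : ‖Matrix.toEuclideanLin A x‖ ≤ F * ‖x‖ := by
    refine le_of_sq_le_sq ?_ (by positivity)
    rw [mul_pow, Real.sq_sqrt (by positivity)]
    exact norm_toEuclideanLin_sq_le A x
  have h1 : ⟪Matrix.toEuclideanLin A x, v⟫ ≤ F * ‖x‖ * ‖v‖ :=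
    (real_inner_le_norm _ _).trans (mul_le_mul_of_nonneg_right hAx (norm_nonneg v))
  set w₁ := fun i => ⟪b₁ i, x⟫ + c₁ i with hw₁
  set w₂ := fun i => ⟪b₂ i, x⟫ + c₂ i with hw₂
  have h2 := le_of_abs_le (abs_softmax_mean_inner_le w₁ (fun i => b₁ i - dv i) v)
  have h3 := neg_le_of_abs_le (abs_softmax_mean_inner_le w₂ (fun i => b₂ i - dv i) v)
  simp only [inner_sub_left, mul_sub, Finset.sum_sub_distrib] at h2 h3
  have hw : ∀ i, |w₁ i - w₂ i| ≤ (α + β) * ‖x‖ + (γ + ε) := by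
    intro i
    have e1 : w₁ i - w₂ i =
        (⟪b₁ i - dv i, x⟫ - ⟪b₂ i - dv i, x⟫) + ((c₁ i - e i) - (c₂ i - e i)) := by
      simp only [hw₁, hw₂, inner_sub_left]; ring
    rw [e1, add_mul]
    refine (abs_add_le _ _).trans (add_le_add ((abs_sub _ _).trans (add_le_add ?_ ?_))
      ((abs_sub _ _).trans (add_le_add ?_ ?_)))
    · exact (abs_real_inner_le_norm _ _).trans (mul_le_mul_of_nonneg_right
        (norm_le_sqrt_sum_norm_sq (fun i => b₁ i - dv i) i) (norm_nonneg x))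
    · exact (abs_real_inner_le_norm _ _).trans (mul_le_mul_of_nonneg_right
        (norm_le_sqrt_sum_norm_sq (fun i => b₂ i - dv i) i) (norm_nonneg x))
    · exact norm_le_sqrt_sum_norm_sq (fun i => c₁ i - e i) i
    · exact norm_le_sqrt_sum_norm_sq (fun i => c₂ i - e i) i
  have h4 := softmax_mean_sub_le w₂ w₁ (fun i => ⟪dv i, v⟫) hw (n := ‖v‖) fun i =>
    (abs_real_inner_le_norm _ _).trans (mul_le_of_le_one_left (norm_nonneg v) (hdv i))
  simp only [softmaxQuadraticDeriv]
  linarith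

lemma softmaxQuadratic_sub_le [Nonempty ι] {A : Matrix (Fin d) (Fin d) ℝ} (hA : A.IsHermitian)
    (b₁ b₂ dv : ι → EuclideanSpace ℝ (Fin d)) (c₁ c₂ e : ι → ℝ) (hdv : ∀ i, ‖dv i‖ ≤ 1)
    {M η : ℝ} (hM : ∀ i, ‖b₁ i‖ ^ 2 ≤ M) (hη1 : η < 1)
    (hη : (⨆ i, hA.eigenvalues i) + 2 * M ≤ η) (x u : EuclideanSpace ℝ (Fin d)) :
    softmaxQuadratic A b₁ b₂ c₁ c₂ u - (1 / 2) * ‖x - u‖ ^ 2 ≤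
      softmaxQuadratic A b₁ b₂ c₁ c₂ x +
        3 * parameterDistSq A b₁ b₂ dv c₁ c₂ e / (1 - η) * (‖x‖ ^ 2 + 1) := by
  have h1 := softmaxQuadratic_add_le hA b₁ b₂ c₁ c₂ hM x (u - x)
  have h2 := softmaxQuadraticDeriv_le A b₁ b₂ dv c₁ c₂ e hdv x (u - x)
  rw [add_sub_cancel] at h1
  rw [norm_sub_rev x u]
  set V := ‖u - x‖
  have hT := parameterDistSq_nonneg A b₁ b₂ dv c₁ c₂ e
  set T := parameterDistSq A b₁ b₂ dv c₁ c₂ e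
  set K := √(6 * (‖x‖ ^ 2 + 1) * T)
  have hK : K ^ 2 = 6 * (‖x‖ ^ 2 + 1) * T := Real.sq_sqrt (by positivity)
  have hη0 : 0 < 1 - η := sub_pos.mpr hη1
  have h3 : K * V - (1 - η) / 2 * V ^ 2 ≤ 3 * T / (1 - η) * (‖x‖ ^ 2 + 1) := by
    rw [div_mul_eq_mul_div (3 * T), le_div_iff₀ hη0]
    nlinarith [sq_nonneg (K - (1 - η) * V)]
  nlinarith [mul_le_mul_of_nonneg_right hη (sq_nonneg V)]

lemma continuous_softmaxQuadratic [Nonempty ι] (A : Matrix (Fin d) (Fin d) ℝ)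
    (b₁ b₂ : ι → EuclideanSpace ℝ (Fin d)) (c₁ c₂ : ι → ℝ) :
    Continuous (softmaxQuadratic A b₁ b₂ c₁ c₂) := by
  have := continuous_toEuclideanLin A
  unfold softmaxQuadratic
  refine ((by fun_prop : Continuous _).add (Continuous.log (by fun_prop) fun x => ?_)).sub
    (Continuous.log (by fun_prop) fun x => ?_)
  · exact (sum_exp_pos _).ne'
  · exact (sum_exp_pos _).ne'

lemma abs_log_sum_exp_inner_le [Nonempty ι] (b : ι → EuclideanSpace ℝ (Fin d)) (c : ι → ℝ)
    (hb : ∀ i, ‖b i‖ ≤ 1) (x : EuclideanSpace ℝ (Fin d)) :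
    |Real.log (∑ i, Real.exp (⟪b i, x⟫ + c i))| ≤ |Real.log (∑ i, Real.exp (c i))| + ‖x‖ := by
  have h := abs_log_sum_exp_add_sub_le c (fun i => ⟪b i, x⟫) (m := ‖x‖) fun i =>
    (abs_real_inner_le_norm _ _).trans (mul_le_of_le_one_left (norm_nonneg x) (hb i))
  simp only [add_comm (c _)] at h
  have := abs_sub_abs_le_abs_sub (Real.log (∑ i, Real.exp (⟪b i, x⟫ + c i)))
    (Real.log (∑ i, Real.exp (c i)))
  linarith

lemma integrable_softmaxQuadratic [Nonempty ι]
    (μ : Measure (EuclideanSpace ℝ (Fin d))) [IsProbabilityMeasure μ]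
    (hmom : Integrable (fun x => ‖x‖ ^ 2) μ) (A : Matrix (Fin d) (Fin d) ℝ)
    (b₁ b₂ : ι → EuclideanSpace ℝ (Fin d)) (c₁ c₂ : ι → ℝ)
    (hb₁ : ∀ i, ‖b₁ i‖ ≤ 1) (hb₂ : ∀ i, ‖b₂ i‖ ≤ 1) :
    Integrable (softmaxQuadratic A b₁ b₂ c₁ c₂) μ := by
  set S := ∑ i, ∑ j, A i j ^ 2
  set C := |Real.log (∑ i, Real.exp (c₁ i))| + |Real.log (∑ i, Real.exp (c₂ i))|
  refine Integrable.mono' (g := fun x => (S + 3) * ‖x‖ ^ 2 + (C + 1))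
    ((hmom.const_mul _).add (integrable_const _))
    (continuous_softmaxQuadratic A b₁ b₂ c₁ c₂).aestronglyMeasurable
    (Filter.Eventually.of_forall fun x => ?_)
  have h1 := abs_le.mp (abs_log_sum_exp_inner_le b₁ c₁ hb₁ x)
  have h2 := abs_le.mp (abs_log_sum_exp_inner_le b₂ c₂ hb₂ x)
  have h3 := abs_le.mp (abs_real_inner_le_norm x (Matrix.toEuclideanLin A x))
  have h4 := norm_toEuclideanLin_sq_le A x
  have h5 : ‖x‖ * ‖Matrix.toEuclideanLin A x‖ ≤ (1 + S) / 2 * ‖x‖ ^ 2 := by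
    nlinarith [sq_nonneg (‖x‖ - ‖Matrix.toEuclideanLin A x‖)]
  have hS0 : 0 ≤ S * ‖x‖ ^ 2 := by positivity
  rw [Real.norm_eq_abs, abs_le]
  unfold softmaxQuadratic
  constructor <;> nlinarith [sq_nonneg (‖x‖ - 1)]

end Discriminator

/-- If an integrable `D` satisfies `D u - ½‖x - u‖² ≤ D x + g x` for all `x` and `u`, then
its c-transform for the quadratic cost has integral at most `∫ D + ∫ g`. -/
lemma integral_cTransform_le {d : ℕ} (μ : Measure (EuclideanSpace ℝ (Fin d)))
    {D g : EuclideanSpace ℝ (Fin d) → ℝ} (hD : Integrable D μ)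
    (hg : Integrable g μ) (h : ∀ x u, D u - (1 / 2) * ‖x - u‖ ^ 2 ≤ D x + g x) :
    ∫ x, (⨆ u, (D u - (1 / 2) * ‖x - u‖ ^ 2)) ∂μ ≤ (∫ x, D x ∂μ) + ∫ x, g x ∂μ := by
  have hbdd : ∀ x, BddAbove (Set.range fun u => D u - (1 / 2) * ‖x - u‖ ^ 2) := fun x =>
    ⟨D x + g x, Set.forall_mem_range.mpr (h x)⟩
  have hmeas : Measurable fun x => ⨆ u, (D u - (1 / 2) * ‖x - u‖ ^ 2) :=
    (lowerSemicontinuous_ciSup hbdd fun u => Continuous.lowerSemicontinuous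
      (by fun_prop : Continuous fun x => D u - (1 / 2) * ‖x - u‖ ^ 2)).measurable
  have hlow : ∀ x, D x ≤ ⨆ u, (D u - (1 / 2) * ‖x - u‖ ^ 2) := fun x => by
    simpa using le_ciSup (hbdd x) x
  have hup : ∀ x, (⨆ u, (D u - (1 / 2) * ‖x - u‖ ^ 2)) ≤ D x + g x := fun x => ciSup_le (h x)
  rw [← integral_add hD hg]
  exact integral_mono (integrable_of_le_of_le hmeas.aestronglyMeasurable
    (Filter.Eventually.of_forall hlow) (Filter.Eventually.of_forall hup) hD (hD.add hg))
    (hD.add hg) hup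

/-- For a probability measure `μ` on `ℝ^d` with finite second moment and the
softmax-quadratic discriminator `D` with `λ_max(A) + 2 maxᵢ‖bᵢ‖² ≤ η < 1`, the c-transform
`D^c(x) = ⨆_u (D(u) − ½‖x − u‖²)` satisfies
`∫ D^c dμ ≤ ∫ D dμ + (3k²(∫‖x‖²dμ + 1)/(1−η))(‖A‖_F² + ∑ᵢ[...])`. -/
theorem stmt4 (d k : ℕ) (hd : 0 < d) (hk : 0 < k)
    (μ : Measure (EuclideanSpace ℝ (Fin d))) [IsProbabilityMeasure μ]
    (hmom : Integrable (fun x => ‖x‖ ^ 2) μ)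
    (A : Matrix (Fin d) (Fin d) ℝ) (hA : A.IsHermitian)
    (b : Fin (2 * k) → EuclideanSpace ℝ (Fin d)) (hb : ∀ i, ‖b i‖ ≤ 1)
    (c : Fin (2 * k) → ℝ)
    (dvec : Fin k → EuclideanSpace ℝ (Fin d)) (hdvec : ∀ i, ‖dvec i‖ ≤ 1)
    (e : Fin k → ℝ)
    (η : ℝ) (hη1 : η < 1)
    (hη : (⨆ i, hA.eigenvalues i) + 2 * (⨆ i, ‖b i‖ ^ 2) ≤ η)
    (D Dc : EuclideanSpace ℝ (Fin d) → ℝ)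
    (hD : D = fun x =>
      (1 / 2) * ⟪x, Matrix.toEuclideanLin A x⟫ +
        Real.log (∑ i : Fin k, Real.exp
          (⟪b (Fin.castLE (by omega) i), x⟫ + c (Fin.castLE (by omega) i))) -
        Real.log (∑ i : Fin k, Real.exp
          (⟪b ⟨k + i, by have := i.isLt; omega⟩, x⟫ + c ⟨k + i, by have := i.isLt; omega⟩)))
    (hDc : Dc = fun x => ⨆ u : EuclideanSpace ℝ (Fin d), (D u - (1 / 2) * ‖x - u‖ ^ 2)) :
    ∫ x, Dc x ∂μ ≤ ∫ x, D x ∂μ +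
      (3 * (k : ℝ) ^ 2 * ((∫ x, ‖x‖ ^ 2 ∂μ) + 1) / (1 - η)) *
        ((∑ i, ∑ j, A i j ^ 2) +
          ∑ i : Fin k,
            (‖b (Fin.castLE (by omega) i) - dvec i‖ ^ 2 +
              ‖b ⟨k + i, by have := i.isLt; omega⟩ - dvec i‖ ^ 2 +
              (c (Fin.castLE (by omega) i) - e i) ^ 2 +
              (c ⟨k + i, by have := i.isLt; omega⟩ - e i) ^ 2)) := by
  have : Nonempty (Fin k) := ⟨⟨0, hk⟩⟩
  set b₁ : Fin k → EuclideanSpace ℝ (Fin d) := fun i => b (Fin.castLE (by omega) i)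
  set b₂ : Fin k → EuclideanSpace ℝ (Fin d) :=
    fun i => b ⟨k + i, by have := i.isLt; omega⟩
  set c₁ : Fin k → ℝ := fun i => c (Fin.castLE (by omega) i)
  set c₂ : Fin k → ℝ := fun i => c ⟨k + i, by have := i.isLt; omega⟩
  have hDs : D = softmaxQuadratic A b₁ b₂ c₁ c₂ := hD
  have hM : ∀ i, ‖b₁ i‖ ^ 2 ≤ ⨆ i, ‖b i‖ ^ 2 := fun i =>
    le_ciSup (f := fun i => ‖b i‖ ^ 2) (Set.finite_range _).bddAbove (Fin.castLE (by omega) i)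
  have hT := parameterDistSq_nonneg A b₁ b₂ dvec c₁ c₂ e
  have hη0 : 0 < 1 - η := sub_pos.mpr hη1
  have hint : Integrable (fun x => 3 * parameterDistSq A b₁ b₂ dvec c₁ c₂ e / (1 - η) *
      (‖x‖ ^ 2 + 1)) μ := (hmom.add (integrable_const 1)).const_mul _
  have hmain := integral_cTransform_le μ
    (integrable_softmaxQuadratic μ hmom A b₁ b₂ c₁ c₂ (fun _ => hb _) (fun _ => hb _)) hint
    (softmaxQuadratic_sub_le hA b₁ b₂ dvec c₁ c₂ e hdvec hM hη1 hη)
  rw [integral_const_mul, integral_add hmom (integrable_const 1)] at hmain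
  simp only [integral_const, probReal_univ, smul_eq_mul, mul_one] at hmain
  rw [hDc, hDs]
  refine hmain.trans (add_le_add_right ?_ _)
  change _ ≤ _ * parameterDistSq A b₁ b₂ dvec c₁ c₂ e
  set T := parameterDistSq A b₁ b₂ dvec c₁ c₂ e
  have hm : 0 ≤ ∫ x, ‖x‖ ^ 2 ∂μ := integral_nonneg fun _ => sq_nonneg _
  have hk2 : (1 : ℝ) ≤ (k : ℝ) ^ 2 := one_le_pow₀ (by exact_mod_cast hk)
  have hpos : 0 ≤ 3 * T / (1 - η) * ((∫ x, ‖x‖ ^ 2 ∂μ) + 1) := by positivity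
  calc _ ≤ (k : ℝ) ^ 2 * (3 * T / (1 - η) * ((∫ x, ‖x‖ ^ 2 ∂μ) + 1)) :=
        le_mul_of_one_le_left hpos hk2
    _ = _ := by ring
end

section
/- Let σ > 0 and let γ = gaussianReal 0 1 be the standard Gaussian measure on ℝ. Then the function g_σ : ℝ → ℝ defined by g_σ(m) = ∫ tanh(m + σz) dγ(z) − m·∫ (1 − tanh(m + σz)²) dγ(z) is strictly monotone increasing on ℝ. -/
open MeasureTheory ProbabilityTheory

theorem Real.one_sub_tanh_sq (x : ℝ) : 1 - Real.tanh x ^ 2 = (Real.cosh x ^ 2)⁻¹ := by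
  have h := (Real.cosh_pos x).ne'
  rw [Real.tanh_eq_sinh_div_cosh]
  field_simp
  linarith [Real.cosh_sq x]

theorem Real.hasDerivAt_tanh (x : ℝ) :
    HasDerivAt Real.tanh (1 - Real.tanh x ^ 2) x := by
  have h := (Real.cosh_pos x).ne'
  have h1 := (Real.hasDerivAt_sinh x).div (Real.hasDerivAt_cosh x) h
  have h2 : Real.tanh = Real.sinh / Real.cosh := funext Real.tanh_eq_sinh_div_cosh
  rw [← h2] at h1
  convert! h1 using 1
  rw [Real.tanh_eq_sinh_div_cosh]
  field_simp

theorem Real.continuous_tanh : Continuous Real.tanh :=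
  continuous_iff_continuousAt.2 fun x => (Real.hasDerivAt_tanh x).continuousAt

theorem Real.abs_one_sub_tanh_sq_le_one (x : ℝ) : |1 - Real.tanh x ^ 2| ≤ 1 := by
  rw [abs_le]
  constructor <;> nlinarith [Real.tanh_sq_lt_one x, sq_nonneg (Real.tanh x)]

theorem Real.one_sub_tanh_sq_lt_of_abs_lt {x y : ℝ} (h : |x| < |y|) :
    1 - Real.tanh y ^ 2 < 1 - Real.tanh x ^ 2 := by
  rw [Real.one_sub_tanh_sq, Real.one_sub_tanh_sq]
  have h1 := Real.cosh_pos x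
  have h2 := Real.cosh_lt_cosh.2 h
  gcongr

theorem gaussianPDFReal_lt_of_sq_lt {a b x y : ℝ} {v : NNReal} (hv : v ≠ 0)
    (h : (x - a) ^ 2 < (y - b) ^ 2) : gaussianPDFReal b v y < gaussianPDFReal a v x := by
  have hv' : (0 : ℝ) < v := by positivity
  unfold gaussianPDFReal
  gcongr

theorem continuous_gaussianPDFReal (m : ℝ) (v : NNReal) : Continuous (gaussianPDFReal m v) := by
  unfold gaussianPDFReal
  fun_prop

/-- The Gaussian average of an even function that strictly decreases in `|x|` is strictly
decreasing in the mean on `[0, ∞)`. -/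
theorem integral_gaussianReal_strictAntiOn {φ : ℝ → ℝ} {C : ℝ} {v : NNReal} (hv : v ≠ 0)
    (hc : Continuous φ) (hC : ∀ x, |φ x| ≤ C) (hφ : ∀ x y, |x| < |y| → φ y < φ x) :
    StrictAntiOn (fun m => ∫ x, φ x ∂(gaussianReal m v)) (Set.Ici 0) := by
  intro a ha b _ hab
  have ha : 0 ≤ a := ha
  simp only [integral_gaussianReal_eq_integral_smul hv, smul_eq_mul]
  have hint (m : ℝ) : Integrable (fun x => gaussianPDFReal m v x * φ x) :=
    (integrable_gaussianPDFReal m v).mul_bdd (c := C) hc.aestronglyMeasurable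
      (Filter.Eventually.of_forall hC)
  set F : ℝ → ℝ := fun x => gaussianPDFReal a v x * φ x - gaussianPDFReal b v x * φ x with hF
  have hFint : Integrable F := (hint a).sub (hint b)
  have hdiff : ∫ x, F x =
      (∫ x, gaussianPDFReal a v x * φ x) - ∫ x, gaussianPDFReal b v x * φ x :=
    integral_sub (hint a) (hint b)
  have hrefl : ∫ x, F (a + b - x) = ∫ x, F x := integral_sub_left_eq_self F volume (a + b)
  have hrefl_eq (x : ℝ) : F x + F (a + b - x) =
      (gaussianPDFReal a v x - gaussianPDFReal b v x) * (φ x - φ (a + b - x)) := by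
    have h1 : gaussianPDFReal a v (a + b - x) = gaussianPDFReal b v x := by
      unfold gaussianPDFReal; ring_nf
    have h2 : gaussianPDFReal b v (a + b - x) = gaussianPDFReal a v x := by
      unfold gaussianPDFReal; ring_nf
    simp only [hF, h1, h2]
    ring
  have hlt {x : ℝ} (hx : x < a + b - x) : 0 < F x + F (a + b - x) := by
    rw [hrefl_eq]
    refine mul_pos (sub_pos.2 (gaussianPDFReal_lt_of_sq_lt hv ?_)) (sub_pos.2 (hφ _ _ ?_))
    · nlinarith
    · rw [← sq_lt_sq]
      nlinarith
  have hpos : 0 < ∫ x, (F x + F (a + b - x)) := by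
    refine integral_pos_of_integrable_nonneg_nonzero (x := a) ?_ ?_ ?_ ?_
    · have := continuous_gaussianPDFReal a v
      have := continuous_gaussianPDFReal b v
      fun_prop
    · exact hFint.add (hFint.comp_sub_left (a + b))
    · intro x
      rcases lt_trichotomy x (a + b - x) with h | h | h
      · exact (hlt h).le
      · simp only [Pi.zero_apply]
        rw [hrefl_eq, ← h]
        simp
      · have := hlt (x := a + b - x) (by linarith)
        rw [sub_sub_cancel, add_comm] at this
        exact this.le
    · exact (hlt (by linarith)).ne'
  rw [integral_add hFint (hFint.comp_sub_left (a + b)), hrefl, hdiff] at hpos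
  linarith

theorem integral_comp_affine_gaussianReal (f : ℝ → ℝ) (hf : Continuous f) (m σ : ℝ) :
    ∫ z, f (m + σ * z) ∂(gaussianReal 0 1) =
      ∫ x, f x ∂(gaussianReal m (.mk (σ ^ 2) (sq_nonneg _))) := by
  have h : (gaussianReal 0 1).map (fun z => m + σ * z) =
      gaussianReal m (.mk (σ ^ 2) (sq_nonneg _)) := by
    have : (fun z => m + σ * z) = (fun x => m + x) ∘ fun z => σ * z := rfl
    rw [this, ← Measure.map_map (by fun_prop) (by fun_prop), gaussianReal_map_const_mul,
      gaussianReal_map_const_add]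
    simp
  rw [← h, integral_map (by fun_prop) hf.aestronglyMeasurable]

theorem integral_gaussianReal_comp_neg (f : ℝ → ℝ) (hf : Continuous f) :
    ∫ z, f (-z) ∂(gaussianReal 0 1) = ∫ z, f z ∂(gaussianReal 0 1) := by
  have h := integral_map (μ := gaussianReal 0 1) (φ := fun z : ℝ => -z) (f := f)
    (by fun_prop) hf.aestronglyMeasurable
  rw [← h, gaussianReal_map_neg, neg_zero]

theorem hasDerivAt_integral_tanh_gaussianReal (σ m : ℝ) :
    HasDerivAt (fun m => ∫ z, Real.tanh (m + σ * z) ∂(gaussianReal 0 1))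
      (∫ z, (1 - Real.tanh (m + σ * z) ^ 2) ∂(gaussianReal 0 1)) m := by
  have hc := Real.continuous_tanh
  refine (hasDerivAt_integral_of_dominated_loc_of_deriv_le
    (F := fun m z => Real.tanh (m + σ * z)) (F' := fun m z => 1 - Real.tanh (m + σ * z) ^ 2)
    (bound := fun _ => 1) (s := Set.univ) Filter.univ_mem ?_ ?_ ?_ ?_
    (integrable_const 1) ?_).2
  · exact Filter.Eventually.of_forall fun x => (by fun_prop : Continuous _).aestronglyMeasurable
  · exact Integrable.of_bound (by fun_prop : Continuous _).aestronglyMeasurable 1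
      (Filter.Eventually.of_forall fun z => (Real.abs_tanh_lt_one _).le)
  · exact (by fun_prop : Continuous _).aestronglyMeasurable
  · exact Filter.Eventually.of_forall fun z x _ => Real.abs_one_sub_tanh_sq_le_one _
  · exact Filter.Eventually.of_forall fun z x _ =>
      (Real.hasDerivAt_tanh _).comp_add_const x (σ * z)

/-- For `σ > 0`, the function
`g_σ(m) = E_{z∼N(0,1)}[tanh(m + σz)] − m·E_{z∼N(0,1)}[1 − tanh(m + σz)²]`
is strictly monotone increasing on `ℝ`. -/
theorem stmt6 (σ : ℝ) (hσ : 0 < σ) :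
    StrictMono (fun m : ℝ =>
      (∫ z, Real.tanh (m + σ * z) ∂(gaussianReal 0 1)) -
        m * ∫ z, (1 - Real.tanh (m + σ * z) ^ 2) ∂(gaussianReal 0 1)) := by
  have hc := Real.continuous_tanh
  refine strictMono_of_odd_strictMonoOn_nonneg (fun m => ?_) ?_
  · have h (z : ℝ) : Real.tanh (-m + σ * z) = -Real.tanh (m + σ * -z) := by
      rw [← Real.tanh_neg]
      ring_nf
    simp only [h, neg_sq, integral_neg]
    rw [integral_gaussianReal_comp_neg (fun z => Real.tanh (m + σ * z)) (by fun_prop),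
      integral_gaussianReal_comp_neg (fun z => 1 - Real.tanh (m + σ * z) ^ 2) (by fun_prop)]
    ring
  · have hB : StrictAntiOn
        (fun m => ∫ z, (1 - Real.tanh (m + σ * z) ^ 2) ∂(gaussianReal 0 1)) (Set.Ici 0) := by
      simp only [integral_comp_affine_gaussianReal (fun x => 1 - Real.tanh x ^ 2) (by fun_prop)]
      refine integral_gaussianReal_strictAntiOn ?_ (by fun_prop)
        Real.abs_one_sub_tanh_sq_le_one fun x y => Real.one_sub_tanh_sq_lt_of_abs_lt
      exact fun h => (pow_pos hσ 2).ne' (congrArg NNReal.toReal h)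
    intro a ha b hb hab
    have hA := hasDerivAt_integral_tanh_gaussianReal σ
    obtain ⟨c, hcm, hslope⟩ := exists_hasDerivAt_eq_slope _ _ hab
      (fun x _ => (hA x).continuousAt.continuousWithinAt) fun x _ => hA x
    have ha : 0 ≤ a := ha
    have h1 := hB (show c ∈ Set.Ici 0 from ha.trans hcm.1.le) hb hcm.2
    have h2 := hB ha hb hab
    rw [eq_div_iff (sub_pos.2 hab).ne'] at hslope
    dsimp only at h1 h2 ⊢
    nlinarith [mul_lt_mul_of_pos_right h1 (sub_pos.2 hab), mul_le_mul_of_nonneg_left h2.le ha]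
end

section
/- Let s > 0 and let γ = gaussianReal 0 1 be the standard Gaussian measure on ℝ. Define g : ℝ → ℝ by g(m) = ∫ (m + √(s − m²)·z)·tanh(m + √(s − m²)·z) dγ(z). Then for every m with 0 < m < √s, writing ν = gaussianReal m (s − m²), the function g has derivative at m equal to ∫ tanh(y) dν(y) − m·∫ tanh′(y) dν(y) + (s − 2m²)·∫ tanh″(y) dν(y) − m(s − m²)·∫ tanh‴(y) dν(y), i.e. HasDerivAt g (that expression) m, where tanh′(y) = 1 − tanh(y)², tanh″ = iteratedDeriv 2 Real.tanh, and tanh‴ = iteratedDeriv 3 Real.tanh. -/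
open MeasureTheory ProbabilityTheory

namespace Real

theorem hasDerivAt_tanh_s9 (x : ℝ) : HasDerivAt tanh (1 - tanh x ^ 2) x := by
  have h : tanh = fun y => sinh y / cosh y := funext tanh_eq_sinh_div_cosh
  rw [h]
  have hc := (cosh_pos x).ne'
  refine ((hasDerivAt_sinh x).div (hasDerivAt_cosh x) hc).congr_deriv ?_
  field_simp

theorem continuous_tanh_s9 : Continuous tanh :=
  continuous_iff_continuousAt.2 fun x => (hasDerivAt_tanh_s9 x).continuousAt

theorem iteratedDeriv_two_tanh :
    iteratedDeriv 2 tanh = fun x => -2 * tanh x * (1 - tanh x ^ 2) := by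
  have h1 : deriv tanh = fun x => 1 - tanh x ^ 2 := funext fun x => (hasDerivAt_tanh_s9 x).deriv
  rw [iteratedDeriv_succ, iteratedDeriv_one, h1]
  ext x
  rw [(((hasDerivAt_tanh_s9 x).fun_pow 2).const_sub 1).deriv]
  ring

theorem hasDerivAt_iteratedDeriv_two_tanh (x : ℝ) :
    HasDerivAt (iteratedDeriv 2 tanh) ((6 * tanh x ^ 2 - 2) * (1 - tanh x ^ 2)) x := by
  rw [iteratedDeriv_two_tanh]
  refine (((hasDerivAt_tanh_s9 x).const_mul (-2)).mul
    (((hasDerivAt_tanh_s9 x).pow 2).const_sub 1)).congr_deriv ?_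
  simp
  ring

theorem iteratedDeriv_three_tanh :
    iteratedDeriv 3 tanh = fun x => (6 * tanh x ^ 2 - 2) * (1 - tanh x ^ 2) := by
  rw [iteratedDeriv_succ]
  exact funext fun x => (hasDerivAt_iteratedDeriv_two_tanh x).deriv

theorem hasDerivAt_one_sub_tanh_sq (x : ℝ) :
    HasDerivAt (fun x => 1 - tanh x ^ 2) (iteratedDeriv 2 tanh x) x := by
  rw [iteratedDeriv_two_tanh]
  refine (((hasDerivAt_tanh_s9 x).pow 2).const_sub 1).congr_deriv ?_
  simp

theorem abs_tanh_le_one (x : ℝ) : |tanh x| ≤ 1 :=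
  abs_le.2 ⟨(neg_one_lt_tanh x).le, (tanh_lt_one x).le⟩

theorem abs_one_sub_tanh_sq_le_one_s9 (x : ℝ) : |1 - tanh x ^ 2| ≤ 1 := by
  have h := (sq_le_one_iff_abs_le_one _).2 (abs_tanh_le_one x)
  rw [abs_le]
  constructor <;> nlinarith [sq_nonneg (tanh x)]

theorem abs_iteratedDeriv_two_tanh_le (x : ℝ) : |iteratedDeriv 2 tanh x| ≤ 2 := by
  rw [iteratedDeriv_two_tanh, abs_mul, abs_mul, abs_neg, abs_two]
  nlinarith [abs_tanh_le_one x, abs_one_sub_tanh_sq_le_one_s9 x, abs_nonneg (tanh x),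
    abs_nonneg (1 - tanh x ^ 2)]

theorem abs_iteratedDeriv_three_tanh_le (x : ℝ) : |iteratedDeriv 3 tanh x| ≤ 4 := by
  have h := (sq_le_one_iff_abs_le_one _).2 (abs_tanh_le_one x)
  have h' : |6 * tanh x ^ 2 - 2| ≤ 4 := by
    rw [abs_le]
    constructor <;> nlinarith [sq_nonneg (tanh x)]
  rw [iteratedDeriv_three_tanh, abs_mul]
  nlinarith [abs_one_sub_tanh_sq_le_one_s9 x, abs_nonneg (6 * tanh x ^ 2 - 2),
    abs_nonneg (1 - tanh x ^ 2)]

theorem continuous_iteratedDeriv_two_tanh : Continuous (iteratedDeriv 2 tanh) :=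
  continuous_iff_continuousAt.2 fun x => (hasDerivAt_iteratedDeriv_two_tanh x).continuousAt

theorem continuous_iteratedDeriv_three_tanh : Continuous (iteratedDeriv 3 tanh) := by
  rw [iteratedDeriv_three_tanh]
  have := continuous_tanh_s9
  fun_prop

end Real

namespace ProbabilityTheory

theorem integrable_one_add_abs_sq_gaussianReal (C : ℝ) :
    Integrable (fun z : ℝ => C * (1 + |z|) ^ 2) (gaussianReal 0 1) := by
  have h1 : MemLp (fun z : ℝ => 1 + |z|) 2 (gaussianReal 0 1) :=
    (memLp_const (1 : ℝ)).add (memLp_id_gaussianReal (μ := 0) (v := 1) 2).norm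
  exact h1.integrable_sq.const_mul C

theorem integrable_gaussianReal_of_abs_le {f : ℝ → ℝ} (hf : Continuous f) (C : ℝ)
    (hC : ∀ z, |f z| ≤ C * (1 + |z|) ^ 2) : Integrable f (gaussianReal 0 1) :=
  (integrable_one_add_abs_sq_gaussianReal C).mono' hf.aestronglyMeasurable
    (Filter.Eventually.of_forall hC)

theorem integrable_gaussianReal_iff {f : ℝ → ℝ} :
    Integrable f (gaussianReal 0 1) ↔
      Integrable (fun z => f z * gaussianPDFReal 0 1 z) := by
  rw [gaussianReal_of_var_ne_zero 0 one_ne_zero, gaussianPDF_def,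
    integrable_withDensity_iff_integrable_smul₀' (by fun_prop) (by simp)]
  refine integrable_congr (Filter.Eventually.of_forall fun z => ?_)
  simp [ENNReal.toReal_ofReal (gaussianPDFReal_nonneg 0 1 z), mul_comm]

theorem hasDerivAt_gaussianPDFReal (z : ℝ) :
    HasDerivAt (gaussianPDFReal 0 1) (-z * gaussianPDFReal 0 1 z) z := by
  have h : HasDerivAt (fun x : ℝ => -(x - 0) ^ 2 / (2 * (1 : NNReal))) (-z) z := by
    refine ((((hasDerivAt_id z).sub_const 0).pow 2).neg.div_const
      (2 * (1 : NNReal))).congr_deriv ?_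
    simp
    ring
  rw [gaussianPDFReal_def]
  refine (h.exp.const_mul _).congr_deriv ?_
  ring

/-- Stein's identity for the standard Gaussian measure. -/
theorem integral_id_mul_gaussianReal {f f' : ℝ → ℝ} (hf : ∀ z, HasDerivAt f (f' z) z)
    (hfi : Integrable f (gaussianReal 0 1)) (hfi' : Integrable f' (gaussianReal 0 1))
    (hzf : Integrable (fun z => z * f z) (gaussianReal 0 1)) :
    ∫ z, z * f z ∂(gaussianReal 0 1) = ∫ z, f' z ∂(gaussianReal 0 1) := by
  rw [integrable_gaussianReal_iff] at hfi hfi' hzf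
  have key := integral_mul_deriv_eq_deriv_mul_of_integrable (fun z _ => hf z)
    (fun z _ => hasDerivAt_gaussianPDFReal z)
    (hzf.neg.congr (Filter.Eventually.of_forall fun z => by simp; ring)) hfi' hfi
  rw [integral_gaussianReal_eq_integral_smul one_ne_zero,
    integral_gaussianReal_eq_integral_smul one_ne_zero]
  simp only [smul_eq_mul]
  rw [← neg_inj, ← integral_neg, ← integral_neg]
  rw [← integral_neg] at key
  refine Eq.trans (integral_congr_ae (Filter.Eventually.of_forall fun z => ?_)) (key.trans
    (integral_congr_ae (Filter.Eventually.of_forall fun z => ?_)))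
  · ring
  · ring

theorem integral_gaussianReal_eq_integral_standard {f : ℝ → ℝ} (hf : Continuous f) (m σ : ℝ) :
    ∫ y, f y ∂(gaussianReal m (Real.toNNReal (σ ^ 2))) =
      ∫ z, f (m + σ * z) ∂(gaussianReal 0 1) := by
  have h : (gaussianReal 0 1).map (fun z => m + σ * z)
      = gaussianReal m (Real.toNNReal (σ ^ 2)) := by
    have := gaussianReal_map_const_mul (μ := 0) (v := 1) σ
    rw [← Function.comp_def (fun y => m + y) (fun z => σ * z),
      ← Measure.map_map (by fun_prop) (by fun_prop), this, gaussianReal_map_const_add]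
    congr 1
    · simp
    · ext; simp [sq_nonneg]
  rw [← h, integral_map (by fun_prop) hf.aestronglyMeasurable]

theorem abs_add_mul_le {a b K : ℝ} (ha : |a| ≤ K) (hb : |b| ≤ K) (z : ℝ) :
    |a + b * z| ≤ K * (1 + |z|) := by
  calc |a + b * z| ≤ |a| + |b| * |z| := by rw [← abs_mul]; exact abs_add_le _ _
    _ ≤ K + K * |z| := by gcongr
    _ = K * (1 + |z|) := by ring

theorem integrable_comp_affine_gaussianReal {u : ℝ → ℝ} (hu : Continuous u) {A : ℝ}
    (hA : ∀ y, |u y| ≤ A) (m σ : ℝ) :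
    Integrable (fun z => u (m + σ * z)) (gaussianReal 0 1) :=
  Integrable.of_bound (by fun_prop) A (Filter.Eventually.of_forall fun _ => hA _)

theorem integrable_affine_mul_comp_affine_gaussianReal {u : ℝ → ℝ} (hu : Continuous u) {A : ℝ}
    (hA : ∀ y, |u y| ≤ A) (a b m σ : ℝ) :
    Integrable (fun z => (a + b * z) * u (m + σ * z)) (gaussianReal 0 1) :=
  (Integrable.add (integrable_const a)
    (((memLp_id_gaussianReal 1).integrable le_rfl).const_mul b)).mul_bdd (c := A)
    (by fun_prop) (Filter.Eventually.of_forall fun _ => hA _)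

/-- Stein's identity for a bounded function of a Gaussian variable with mean `m` and standard
deviation `σ`. -/
theorem integral_affine_mul_comp_affine_gaussianReal {u u' : ℝ → ℝ}
    (hu : ∀ y, HasDerivAt u (u' y) y) (hu' : Continuous u') {A B : ℝ}
    (hA : ∀ y, |u y| ≤ A) (hB : ∀ y, |u' y| ≤ B) (m σ : ℝ) :
    ∫ z, (m + σ * z) * u (m + σ * z) ∂(gaussianReal 0 1) =
      m * (∫ z, u (m + σ * z) ∂(gaussianReal 0 1)) +
        σ ^ 2 * ∫ z, u' (m + σ * z) ∂(gaussianReal 0 1) := by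
  have hc : Continuous u := continuous_iff_continuousAt.2 fun y => (hu y).continuousAt
  have hi := integrable_comp_affine_gaussianReal hc hA m σ
  have hi' := integrable_comp_affine_gaussianReal hu' hB m σ
  have hz : Integrable (fun z => z * u (m + σ * z)) (gaussianReal 0 1) := by
    simpa using integrable_affine_mul_comp_affine_gaussianReal hc hA 0 1 m σ
  have hd (z : ℝ) : HasDerivAt (fun z => u (m + σ * z)) (σ * u' (m + σ * z)) z := by
    refine ((hu (m + σ * z)).comp z
      (((hasDerivAt_id z).const_mul σ).const_add m)).congr_deriv ?_
    ring
  have stein := integral_id_mul_gaussianReal hd hi (hi'.const_mul σ) hz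
  rw [integral_const_mul] at stein
  calc ∫ z, (m + σ * z) * u (m + σ * z) ∂(gaussianReal 0 1)
      = ∫ z, (m * u (m + σ * z) + σ * (z * u (m + σ * z))) ∂(gaussianReal 0 1) := by
        congr 1; ext z; ring
    _ = _ := by
        rw [integral_add (hi.const_mul m) (hz.const_mul σ), integral_const_mul,
          integral_const_mul, stein]
        ring

theorem abs_tanh_add_mul_le {K y w : ℝ} (hK : 1 ≤ K) (hy : |y| ≤ K * (1 + |w|)) :
    |Real.tanh y + y * (1 - Real.tanh y ^ 2)| ≤ 2 * K * (1 + |w|) := by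
  calc |Real.tanh y + y * (1 - Real.tanh y ^ 2)|
      ≤ |Real.tanh y| + |y| * |1 - Real.tanh y ^ 2| := by rw [← abs_mul]; exact abs_add_le _ _
    _ ≤ 1 + K * (1 + |w|) * 1 := by
        gcongr
        · exact Real.abs_tanh_le_one y
        · exact Real.abs_one_sub_tanh_sq_le_one_s9 y
    _ ≤ 2 * K * (1 + |w|) := by nlinarith [abs_nonneg w]

theorem hasDerivAt_mul_tanh (y : ℝ) :
    HasDerivAt (fun y => y * Real.tanh y) (Real.tanh y + y * (1 - Real.tanh y ^ 2)) y := by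
  refine ((hasDerivAt_id y).mul (Real.hasDerivAt_tanh_s9 y)).congr_deriv ?_
  simp

theorem hasDerivAt_sqrt_sub_sq {s x : ℝ} (hx : 0 < s - x ^ 2) :
    HasDerivAt (fun x => √(s - x ^ 2)) (-(x / √(s - x ^ 2))) x := by
  refine (((hasDerivAt_pow 2 x).const_sub s).sqrt hx.ne').congr_deriv ?_
  have := Real.sqrt_pos.2 hx
  field_simp
  simp [mul_comm]

theorem hasDerivAt_integral_mul_tanh {s m : ℝ} (hm : 0 < s - m ^ 2) :
    HasDerivAt (fun x => ∫ z, (x + √(s - x ^ 2) * z) *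
        Real.tanh (x + √(s - x ^ 2) * z) ∂(gaussianReal 0 1))
      (∫ z, (1 - m / √(s - m ^ 2) * z) * (Real.tanh (m + √(s - m ^ 2) * z) +
        (m + √(s - m ^ 2) * z) * (1 - Real.tanh (m + √(s - m ^ 2) * z) ^ 2))
          ∂(gaussianReal 0 1)) m := by
  have hT := Real.continuous_tanh_s9
  have hσ := (Real.sqrt_pos.2 hm).ne'
  set K : ℝ := |m| + |√(s - m ^ 2)| + |m / √(s - m ^ 2)| + 1 with hK
  have hb1 := abs_nonneg m
  have hb2 := abs_nonneg (√(s - m ^ 2))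
  have hb3 := abs_nonneg (m / √(s - m ^ 2))
  have hK1 : 1 ≤ K := by linarith
  have e0 : ∀ᶠ x in nhds m, 0 < s - x ^ 2 :=
    ContinuousAt.eventually_lt (by fun_prop) (by fun_prop) hm
  have e1 : ∀ᶠ x in nhds m, |x| < K :=
    ContinuousAt.eventually_lt (by fun_prop) (by fun_prop) (by linarith)
  have e2 : ∀ᶠ x in nhds m, |√(s - x ^ 2)| < K :=
    ContinuousAt.eventually_lt (by fun_prop) (by fun_prop) (by linarith)
  have e3 : ∀ᶠ x in nhds m, |x / √(s - x ^ 2)| < K :=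
    ContinuousAt.eventually_lt (by fun_prop (disch := assumption)) (by fun_prop) (by linarith)
  refine (hasDerivAt_integral_of_dominated_loc_of_deriv_le
    (F' := fun x z => (1 - x / √(s - x ^ 2) * z) * (Real.tanh (x + √(s - x ^ 2) * z) +
        (x + √(s - x ^ 2) * z) * (1 - Real.tanh (x + √(s - x ^ 2) * z) ^ 2)))
    (bound := fun z => 2 * K ^ 2 * (1 + |z|) ^ 2)
    (e0.and (e1.and (e2.and e3))) (Filter.Eventually.of_forall fun x => by fun_prop)
    (integrable_affine_mul_comp_affine_gaussianReal hT Real.abs_tanh_le_one _ _ _ _)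
    (by fun_prop) (Filter.Eventually.of_forall fun z x hx => ?_)
    (integrable_one_add_abs_sq_gaussianReal _)
    (Filter.Eventually.of_forall fun z x hx => ?_)).2
  · obtain ⟨-, h1, h2, h3⟩ := hx
    have hl : |1 - x / √(s - x ^ 2) * z| ≤ K * (1 + |z|) := by
      rw [sub_eq_add_neg, ← neg_mul]
      exact abs_add_mul_le (by simpa using hK1) (by rw [abs_neg]; exact h3.le) z
    have hr := abs_tanh_add_mul_le hK1 (abs_add_mul_le h1.le h2.le z)
    rw [Real.norm_eq_abs, abs_mul]
    calc _ ≤ (K * (1 + |z|)) * (2 * K * (1 + |z|)) := by gcongr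
      _ = _ := by ring
  · refine ((hasDerivAt_mul_tanh (x + √(s - x ^ 2) * z)).comp x
      ((hasDerivAt_id x).add ((hasDerivAt_sqrt_sub_sq hx.1).mul_const z))).congr_deriv ?_
    ring

theorem integral_one_sub_mul_deriv_mul_tanh {m σ : ℝ} (hσ : σ ≠ 0) :
    ∫ z, (1 - m / σ * z) * (Real.tanh (m + σ * z) +
        (m + σ * z) * (1 - Real.tanh (m + σ * z) ^ 2)) ∂(gaussianReal 0 1) =
      (∫ z, Real.tanh (m + σ * z) ∂(gaussianReal 0 1)) -
        m * (∫ z, (1 - Real.tanh (m + σ * z) ^ 2) ∂(gaussianReal 0 1)) +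
        (σ ^ 2 - m ^ 2) * (∫ z, iteratedDeriv 2 Real.tanh (m + σ * z) ∂(gaussianReal 0 1)) -
        m * σ ^ 2 * (∫ z, iteratedDeriv 3 Real.tanh (m + σ * z) ∂(gaussianReal 0 1)) := by
  have c0 := Real.continuous_tanh_s9
  have c1 : Continuous fun y => 1 - Real.tanh y ^ 2 := by fun_prop
  have c2 := Real.continuous_iteratedDeriv_two_tanh
  have c3 := Real.continuous_iteratedDeriv_three_tanh
  have d2 (y : ℝ) : HasDerivAt (iteratedDeriv 2 Real.tanh) (iteratedDeriv 3 Real.tanh y) y := by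
    rw [Real.iteratedDeriv_three_tanh]
    exact Real.hasDerivAt_iteratedDeriv_two_tanh y
  have i0 := integrable_comp_affine_gaussianReal c0 Real.abs_tanh_le_one m σ
  have i1 := integrable_comp_affine_gaussianReal c1 Real.abs_one_sub_tanh_sq_le_one_s9 m σ
  have j1 := integrable_affine_mul_comp_affine_gaussianReal c1 Real.abs_one_sub_tanh_sq_le_one_s9
    m σ m σ
  have j2 := integrable_affine_mul_comp_affine_gaussianReal c2 Real.abs_iteratedDeriv_two_tanh_le
    m σ m σ
  have s1 := integral_affine_mul_comp_affine_gaussianReal Real.hasDerivAt_one_sub_tanh_sq c2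
    Real.abs_one_sub_tanh_sq_le_one_s9 Real.abs_iteratedDeriv_two_tanh_le m σ
  have s2 := integral_affine_mul_comp_affine_gaussianReal d2 c3
    Real.abs_iteratedDeriv_two_tanh_le Real.abs_iteratedDeriv_three_tanh_le m σ
  have hd (z : ℝ) : HasDerivAt
      (fun z => Real.tanh (m + σ * z) + (m + σ * z) * (1 - Real.tanh (m + σ * z) ^ 2))
      (σ * (2 * (1 - Real.tanh (m + σ * z) ^ 2) +
        (m + σ * z) * iteratedDeriv 2 Real.tanh (m + σ * z))) z := by
    have hy : HasDerivAt (fun z => m + σ * z) (σ * 1) z :=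
      ((hasDerivAt_id z).const_mul σ).const_add m
    have h1 := (Real.hasDerivAt_tanh_s9 (m + σ * z)).comp z hy
    have h2 := (Real.hasDerivAt_one_sub_tanh_sq (m + σ * z)).comp z hy
    refine (h1.add (hy.mul h2)).congr_deriv ?_
    simp only [Function.comp_apply]
    ring
  have ih : Integrable (fun z => Real.tanh (m + σ * z) +
      (m + σ * z) * (1 - Real.tanh (m + σ * z) ^ 2)) (gaussianReal 0 1) := i0.add j1
  have ih' := (i1.const_mul 2).add j2
  have izh : Integrable (fun z => z * (Real.tanh (m + σ * z) +
      (m + σ * z) * (1 - Real.tanh (m + σ * z) ^ 2))) (gaussianReal 0 1) := by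
    set K : ℝ := |m| + |σ| + 1
    have hb1 := abs_nonneg m
    have hb2 := abs_nonneg σ
    have hK1 : 1 ≤ K := by linarith
    refine integrable_gaussianReal_of_abs_le (by fun_prop) (2 * K) fun z => ?_
    have hr := abs_tanh_add_mul_le hK1
      (abs_add_mul_le (a := m) (b := σ) (by linarith) (by linarith) z)
    rw [abs_mul]
    calc _ ≤ (1 + |z|) * (2 * K * (1 + |z|)) := by gcongr; linarith
      _ = _ := by ring
  have stein := integral_id_mul_gaussianReal hd ih (ih'.const_mul σ) izh
  rw [integral_const_mul, integral_add (i1.const_mul 2) j2, integral_const_mul, s2] at stein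
  calc _ = ∫ z, ((Real.tanh (m + σ * z) + (m + σ * z) * (1 - Real.tanh (m + σ * z) ^ 2)) -
        m / σ * (z * (Real.tanh (m + σ * z) +
          (m + σ * z) * (1 - Real.tanh (m + σ * z) ^ 2)))) ∂(gaussianReal 0 1) := by
        congr 1; ext z; ring
    _ = _ := by
        rw [integral_sub ih (izh.const_mul _), integral_const_mul, stein, integral_add i0 j1, s1]
        field_simp
        ring

end ProbabilityTheory

/-- For `s > 0` let `g(m) = E_{z∼N(0,1)}[(m + √(s−m²)z)·tanh(m + √(s−m²)z)]`.
For every `0 < m < √s`, writing `ν = gaussianReal m (s − m²)`, `g` has derivative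
`E_ν[tanh] − m·E_ν[tanh′] + (s − 2m²)·E_ν[tanh″] − m(s − m²)·E_ν[tanh‴]` at `m`. -/
theorem stmt9 (s : ℝ) (hs : 0 < s)
    (g : ℝ → ℝ)
    (hg : g = fun m => ∫ z, (m + Real.sqrt (s - m ^ 2) * z) *
      Real.tanh (m + Real.sqrt (s - m ^ 2) * z) ∂(gaussianReal 0 1))
    (m : ℝ) (hm0 : 0 < m) (hms : m < Real.sqrt s)
    (ν : Measure ℝ) (hν : ν = gaussianReal m (Real.toNNReal (s - m ^ 2))) :
    HasDerivAt g
      ((∫ y, Real.tanh y ∂ν) - m * (∫ y, (1 - Real.tanh y ^ 2) ∂ν) +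
        (s - 2 * m ^ 2) * (∫ y, iteratedDeriv 2 Real.tanh y ∂ν) -
        m * (s - m ^ 2) * (∫ y, iteratedDeriv 3 Real.tanh y ∂ν)) m := by
  have hm : 0 < s - m ^ 2 := sub_pos.2 ((Real.lt_sqrt hm0.le).1 hms)
  have hσ := Real.sqrt_pos.2 hm
  have hsq : s - m ^ 2 = √(s - m ^ 2) ^ 2 := (Real.sq_sqrt hm.le).symm
  have hT := Real.continuous_tanh_s9
  have key := hasDerivAt_integral_mul_tanh hm
  rw [integral_one_sub_mul_deriv_mul_tanh hσ.ne'] at key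
  subst hg
  rw [hν, hsq, integral_gaussianReal_eq_integral_standard hT,
    integral_gaussianReal_eq_integral_standard (f := fun y => 1 - Real.tanh y ^ 2) (by fun_prop),
    integral_gaussianReal_eq_integral_standard Real.continuous_iteratedDeriv_two_tanh,
    integral_gaussianReal_eq_integral_standard Real.continuous_iteratedDeriv_three_tanh]
  have hs2 : s - 2 * m ^ 2 = √(s - m ^ 2) ^ 2 - m ^ 2 := by rw [← hsq]; ring
  rw [hs2]
  exact key
end
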